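/- There is an injective homomorphism of Lie superalgebras ψ: osp(1|2) → W(2n|n) determined by ψ(x)=(i/√2)γ^i∂_i, ψ(y)=(i/√2)γ^i x_i, ψ(h)=-(1/2)(∂_i x^i+x^i∂_i), ψ(e)=-(1/2)∂^i∂_i, ψ(f)=(1/2)x^i x_i, where W(2n|n) carries the supercommutator Lie superalgebra structure. -/

import Mathlib

open TensorProduct in
/-- The space `V = Cl(ℂ^n, η) ⊗ ℂ[x^1,…,x^n]` of Clifford-algebra-valued polynomials,
where the Clifford algebra is taken for the quadratic form `v ↦ vᵀ η v` (whose polar form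
has matrix `2η`, so that `γ^i γ^j + γ^j γ^i = 2η^{ij}`). -/
abbrev WCModule (n : ℕ) (η : Matrix (Fin n) (Fin n) ℂ) : Type :=
  CliffordAlgebra (Matrix.toQuadraticMap' η) ⊗[ℂ] MvPolynomial (Fin n) ℂ

/-- The `i`-th Clifford generator `γ^i = ι(e_i)`. -/
noncomputable def gammaElem {n : ℕ} (η : Matrix (Fin n) (Fin n) ℂ) (i : Fin n) :
    CliffordAlgebra (Matrix.toQuadraticMap' η) :=
  CliffordAlgebra.ι (Matrix.toQuadraticMap' η) (Pi.single i 1)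

/-- Multiplication by `x^i` on Clifford-valued polynomials. -/
noncomputable def xop {n : ℕ} (η : Matrix (Fin n) (Fin n) ℂ) (i : Fin n) :
    Module.End ℂ (WCModule n η) :=
  LinearMap.lTensor _ (LinearMap.mulLeft ℂ (MvPolynomial.X i))

/-- The partial derivative `∂_i` on Clifford-valued polynomials. -/
noncomputable def dop {n : ℕ} (η : Matrix (Fin n) (Fin n) ℂ) (i : Fin n) :
    Module.End ℂ (WCModule n η) :=
  LinearMap.lTensor _ (MvPolynomial.pderiv i).toLinearMap

/-- Left multiplication by `γ^i` on Clifford-valued polynomials. -/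
noncomputable def gop {n : ℕ} (η : Matrix (Fin n) (Fin n) ℂ) (i : Fin n) :
    Module.End ℂ (WCModule n η) :=
  LinearMap.rTensor _ (LinearMap.mulLeft ℂ (gammaElem η i))

/-- `X = ψ(x) = (i/√2) γ^i ∂_i` acting on Clifford-valued polynomials. -/
noncomputable def Xop {n : ℕ} (η : Matrix (Fin n) (Fin n) ℂ) : Module.End ℂ (WCModule n η) :=
  (Complex.I / (Real.sqrt 2 : ℂ)) • ∑ i, gop η i * dop η i

/-- `Y = ψ(y) = (i/√2) γ^i x_i` (with `x_i = η_{ij} x^j`, `ηinv = (η_{ij})`). -/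
noncomputable def Yop {n : ℕ} (η ηinv : Matrix (Fin n) (Fin n) ℂ) :
    Module.End ℂ (WCModule n η) :=
  (Complex.I / (Real.sqrt 2 : ℂ)) • ∑ i, gop η i * (∑ j, ηinv i j • xop η j)

/-- `H = ψ(h) = -(1/2)(∂_i x^i + x^i ∂_i)`. -/
noncomputable def Hop {n : ℕ} (η : Matrix (Fin n) (Fin n) ℂ) : Module.End ℂ (WCModule n η) :=
  (-(1/2) : ℂ) • ∑ i, (dop η i * xop η i + xop η i * dop η i)

/-- `E = ψ(e) = -(1/2) ∂^i ∂_i` (with `∂^i = η^{ij} ∂_j`). -/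
noncomputable def Eop {n : ℕ} (η : Matrix (Fin n) (Fin n) ℂ) : Module.End ℂ (WCModule n η) :=
  (-(1/2) : ℂ) • ∑ i, (∑ j, η i j • dop η j) * dop η i

/-- `F = ψ(f) = (1/2) x^i x_i`. -/
noncomputable def Fop {n : ℕ} (η ηinv : Matrix (Fin n) (Fin n) ℂ) :
    Module.End ℂ (WCModule n η) :=
  ((1:ℂ)/2) • ∑ i, xop η i * (∑ j, ηinv i j • xop η j)

namespace SuperOscillator

variable {ι A : Type*} [Fintype ι] [Ring A]

theorem number_operator_commutator_annihilation [DecidableEq ι] (x d : ι → A)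
    (hdx : ∀ i j, d i * x j - x j * d i = if i = j then 1 else 0)
    (hdd : ∀ i j, d i * d j = d j * d i) (j : ι) :
    (∑ i, x i * d i) * d j - d j * (∑ i, x i * d i) = -d j := by
  rw [Finset.sum_mul, Finset.mul_sum, ← Finset.sum_sub_distrib]
  have (i : ι) : x i * d i * d j - d j * (x i * d i) = -((if j = i then 1 else 0) * d i) := by
    rw [← hdx, mul_assoc, hdd]; noncomm_ring
  simp [this]

theorem number_operator_commutator_creation [DecidableEq ι] (x d : ι → A)
    (hdx : ∀ i j, d i * x j - x j * d i = if i = j then 1 else 0)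
    (hxx : ∀ i j, x i * x j = x j * x i) (j : ι) :
    (∑ i, x i * d i) * x j - x j * (∑ i, x i * d i) = x j := by
  rw [Finset.sum_mul, Finset.mul_sum, ← Finset.sum_sub_distrib]
  have (i : ι) : x i * d i * x j - x j * (x i * d i) = x i * (if i = j then 1 else 0) := by
    rw [← hdx, ← mul_assoc (x j), hxx j]; noncomm_ring
  simp [this]

variable [Algebra ℂ A]

/-- The supercommutator of two odd elements `∑ γ^i a_i` and `∑ γ^j b_j`. -/
theorem clifford_sum_anticommutator (η k : ι → ι → ℂ) (g a b : ι → A)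
    (hg : ∀ i j, g i * g j + g j * g i = (2 * η i j) • (1 : A))
    (hga : ∀ i j, g i * a j = a j * g i) (hgb : ∀ i j, g i * b j = b j * g i)
    (hab : ∀ i j, a i * b j - b j * a i = k i j • (1 : A)) :
    (∑ i, g i * a i) * (∑ j, g j * b j) + (∑ j, g j * b j) * (∑ i, g i * a i) =
      ∑ i, ∑ j, ((2 * η i j) • (a i * b j) - k i j • (g j * g i)) := by
  rw [Finset.sum_mul_sum, Finset.sum_mul_sum, Finset.sum_comm (γ := ι) (s := Finset.univ)
    (f := fun j i => g j * b j * (g i * a i)), ← Finset.sum_add_distrib]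
  refine Finset.sum_congr rfl fun i _ => ?_
  rw [← Finset.sum_add_distrib]
  refine Finset.sum_congr rfl fun j _ => ?_
  have h1 : g i * a i * (g j * b j) = g i * g j * (a i * b j) := by
    rw [mul_assoc, ← mul_assoc (a i), ← hga]; simp only [mul_assoc]
  have h2 : g j * b j * (g i * a i) = g j * g i * (b j * a i) := by
    rw [mul_assoc, ← mul_assoc (b j), ← hgb]; simp only [mul_assoc]
  have h3 : b j * a i = a i * b j - k i j • (1 : A) := by rw [← hab]; abel
  rw [h1, h2, h3, mul_sub, ← add_sub_assoc, ← add_mul, hg]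
  simp

theorem sum_inverse_smul_clifford [DecidableEq ι] (η ηinv : Matrix ι ι ℂ) (g : ι → A)
    (hg : ∀ i j, g i * g j + g j * g i = (2 * η i j) • (1 : A))
    (hsym' : ∀ i j, ηinv i j = ηinv j i) (hη : η * ηinv = 1) :
    ∑ i, ∑ j, ηinv i j • (g j * g i) = (Fintype.card ι : ℂ) • (1 : A) := by
  have htr : ∑ i, ∑ j, η i j * ηinv i j = (Fintype.card ι : ℂ) := by
    have := congrArg Matrix.trace hη
    rw [Matrix.trace_one] at this
    rw [← this]
    simp only [Matrix.trace, Matrix.diag, Matrix.mul_apply]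
    exact Finset.sum_congr rfl fun i _ => Finset.sum_congr rfl fun j _ => by rw [hsym' i j]
  have hswap : ∑ i, ∑ j, ηinv i j • (g j * g i) = ∑ i, ∑ j, ηinv i j • (g i * g j) := by
    rw [Finset.sum_comm]
    exact Finset.sum_congr rfl fun i _ => Finset.sum_congr rfl fun j _ => by rw [hsym' i j]
  have h2 : (2 : ℂ) • ∑ i, ∑ j, ηinv i j • (g j * g i) =
      (2 : ℂ) • (Fintype.card ι : ℂ) • (1 : A) := by
    rw [two_smul]
    nth_rewrite 1 [hswap]
    simp only [← Finset.sum_add_distrib, ← smul_add, hg, smul_smul, ← Finset.sum_smul]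
    rw [← htr, Finset.mul_sum]
    simp only [Finset.mul_sum]
    congr 1
    exact Finset.sum_congr rfl fun i _ => Finset.sum_congr rfl fun j _ => by ring
  exact smul_right_injective A (two_ne_zero (α := ℂ)) h2

theorem commutator_smul_sum_clifford (h : A) (c w : ℂ) (g a : ι → A)
    (hg : ∀ i, h * g i = g i * h) (ha : ∀ i, h * a i - a i * h = w • a i) :
    h * (c • ∑ i, g i * a i) - (c • ∑ i, g i * a i) * h = w • c • ∑ i, g i * a i := by
  rw [mul_smul_comm, smul_mul_assoc, ← smul_sub, smul_comm w, Finset.sum_mul, Finset.mul_sum,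
    ← Finset.sum_sub_distrib, Finset.smul_sum (r := w)]
  congr 1
  refine Finset.sum_congr rfl fun i _ => ?_
  rw [← mul_assoc, hg, mul_assoc, mul_assoc, ← mul_sub, ha, mul_smul_comm]

theorem I_div_sqrt_two_mul_self :
    Complex.I / (Real.sqrt 2 : ℂ) * (Complex.I / (Real.sqrt 2 : ℂ)) = -(1 / 2) := by
  have h : (Real.sqrt 2 : ℂ) * (Real.sqrt 2 : ℂ) = 2 := by
    rw [← Complex.ofReal_mul, Real.mul_self_sqrt zero_le_two]; simp
  rw [div_mul_div_comm, h, Complex.I_mul_I]; norm_num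

/-- Elements `g i`, `x i`, `d i` of an algebra obeying the relations of the generators
`γ^i`, `x^i`, `∂_i` of the Weyl–Clifford superalgebra. -/
structure WeylCliffordRelations [DecidableEq ι] (η : Matrix ι ι ℂ) (g x d : ι → A) : Prop where
  clifford : ∀ i j, g i * g j + g j * g i = (2 * η i j) • (1 : A)
  g_x : ∀ i j, g i * x j = x j * g i
  g_d : ∀ i j, g i * d j = d j * g i
  x_x : ∀ i j, x i * x j = x j * x i
  d_d : ∀ i j, d i * d j = d j * d i
  d_x : ∀ i j, d i * x j = x j * d i + if i = j then 1 else 0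

/-- The lowered coordinate `x_i = η_{ij} x^j`. -/
def lower (ηinv : Matrix ι ι ℂ) (x : ι → A) (i : ι) : A := ∑ j, ηinv i j • x j

/-- `(i/√2) γ^i a_i`. -/
noncomputable def slash (g a : ι → A) : A := (Complex.I / (Real.sqrt 2 : ℂ)) • ∑ i, g i * a i

/-- `-(1/2)(∂_i x^i + x^i ∂_i)`. -/
noncomputable def weight (x d : ι → A) : A := (-(1/2) : ℂ) • ∑ i, (d i * x i + x i * d i)

/-- `-(1/2) ∂^i ∂_i`. -/
noncomputable def raising (η : Matrix ι ι ℂ) (d : ι → A) : A :=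
  (-(1/2) : ℂ) • ∑ i, lower η d i * d i

/-- `(1/2) x^i x_i`. -/
noncomputable def lowering (ηinv : Matrix ι ι ℂ) (x : ι → A) : A :=
  ((1:ℂ)/2) • ∑ i, x i * lower ηinv x i

variable [DecidableEq ι] {η ηinv : Matrix ι ι ℂ} {g x d : ι → A}

theorem sum_smul_lower (hη : η * ηinv = 1) (i : ι) :
    ∑ j, η i j • lower ηinv x j = x i := by
  simp only [lower, Finset.smul_sum, smul_smul]
  rw [Finset.sum_comm]
  simp only [← Finset.sum_smul, ← Matrix.mul_apply, hη, Matrix.one_apply]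
  simp

namespace WeylCliffordRelations

theorem weight_eq (R : WeylCliffordRelations η g x d) :
    weight x d = -(∑ i, x i * d i) - ((Fintype.card ι : ℂ) / 2) • (1 : A) := by
  have h (i : ι) : d i * x i + x i * d i = (2 : ℂ) • (x i * d i) + 1 := by
    rw [R.d_x, if_pos rfl, two_smul]; abel
  simp only [weight, h, Finset.sum_add_distrib, ← Finset.smul_sum, Finset.sum_const,
    Finset.card_univ, ← Nat.cast_smul_eq_nsmul ℂ]
  module

theorem weight_mul_g (R : WeylCliffordRelations η g x d) (i : ι) :
    weight x d * g i = g i * weight x d := by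
  have h (j : ι) : x j * d j * g i = g i * (x j * d j) := by
    rw [mul_assoc, ← R.g_d, ← mul_assoc, ← R.g_x, mul_assoc]
  simp only [R.weight_eq, sub_mul, mul_sub, neg_mul, mul_neg, Finset.sum_mul, Finset.mul_sum, h,
    smul_mul_assoc, mul_smul_comm, one_mul, mul_one]

theorem weight_commutator (R : WeylCliffordRelations η g x d) (a : A) :
    weight x d * a - a * weight x d = -((∑ i, x i * d i) * a - a * (∑ i, x i * d i)) := by
  simp only [R.weight_eq, sub_mul, mul_sub, neg_mul, mul_neg, smul_mul_assoc, mul_smul_comm,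
    one_mul, mul_one]
  abel

theorem weight_commutator_d (R : WeylCliffordRelations η g x d) (i : ι) :
    weight x d * d i - d i * weight x d = (1 : ℂ) • d i := by
  rw [R.weight_commutator, number_operator_commutator_annihilation x d
    (fun i j => sub_eq_of_eq_add' (R.d_x i j)) R.d_d,
    neg_neg, one_smul]

theorem weight_commutator_lower (R : WeylCliffordRelations η g x d) (i : ι) :
    weight x d * lower ηinv x i - lower ηinv x i * weight x d = (-1 : ℂ) • lower ηinv x i := by
  have h (j : ι) : weight x d * x j - x j * weight x d = -x j := by
    rw [R.weight_commutator, number_operator_commutator_creation x d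
    (fun i j => sub_eq_of_eq_add' (R.d_x i j)) R.x_x]
  simp only [lower, Finset.mul_sum, Finset.sum_mul, mul_smul_comm, smul_mul_assoc,
    ← Finset.sum_sub_distrib, ← smul_sub, h, smul_neg, Finset.sum_neg_distrib, neg_smul, one_smul]

theorem g_mul_lower (R : WeylCliffordRelations η g x d) (i j : ι) :
    g i * lower ηinv x j = lower ηinv x j * g i := by
  simp only [lower, Finset.mul_sum, Finset.sum_mul, mul_smul_comm, smul_mul_assoc, R.g_x]

theorem x_mul_lower (R : WeylCliffordRelations η g x d) (i j : ι) :
    x i * lower ηinv x j = lower ηinv x j * x i := by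
  simp only [lower, Finset.mul_sum, Finset.sum_mul, mul_smul_comm, smul_mul_assoc, R.x_x i]

theorem lower_mul_lower (R : WeylCliffordRelations η g x d) (i j : ι) :
    lower ηinv x i * lower ηinv x j = lower ηinv x j * lower ηinv x i := by
  rw [lower.eq_def ηinv x i]
  simp only [Finset.mul_sum, Finset.sum_mul, mul_smul_comm, smul_mul_assoc, R.x_mul_lower]

theorem lower_d_commutator (R : WeylCliffordRelations η g x d) (i j : ι) :
    lower ηinv x i * d j - d j * lower ηinv x i = (-ηinv i j) • (1 : A) := by
  have h (k : ι) : x k * d j - d j * x k = -(if j = k then 1 else 0) := by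
    rw [R.d_x]; abel
  simp only [lower, Finset.mul_sum, Finset.sum_mul, mul_smul_comm, smul_mul_assoc,
    ← Finset.sum_sub_distrib, ← smul_sub, h]
  simp

theorem weight_commutator_slash_d (R : WeylCliffordRelations η g x d) :
    weight x d * slash g d - slash g d * weight x d = slash g d := by
  have h := commutator_smul_sum_clifford (weight x d) (Complex.I / (Real.sqrt 2 : ℂ)) 1 g d
    R.weight_mul_g R.weight_commutator_d
  rwa [one_smul] at h

theorem weight_commutator_slash_lower (R : WeylCliffordRelations η g x d) :
    weight x d * slash g (lower ηinv x) - slash g (lower ηinv x) * weight x d =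
      -slash g (lower ηinv x) := by
  have h := commutator_smul_sum_clifford (weight x d) (Complex.I / (Real.sqrt 2 : ℂ)) (-1)
    g (lower ηinv x) R.weight_mul_g R.weight_commutator_lower
  rwa [neg_one_smul] at h

theorem slash_d_sq (R : WeylCliffordRelations η g x d) : slash g d * slash g d = raising η d := by
  have h := clifford_sum_anticommutator η 0 g d d R.clifford R.g_d R.g_d (by simp [R.d_d])
  have hs : ∑ i, ∑ j, (2 * η i j) • (d i * d j) = (2 : ℂ) • ∑ i, lower η d i * d i := by
    simp only [lower, Finset.smul_sum, Finset.sum_mul, smul_mul_assoc, mul_smul]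
    exact Finset.sum_congr rfl fun i _ => Finset.sum_congr rfl fun j _ => by rw [R.d_d]
  simp only [Pi.zero_apply, zero_smul, sub_zero, hs, ← two_smul ℂ] at h
  rw [slash, smul_mul_smul_comm, I_div_sqrt_two_mul_self, raising,
    smul_right_injective A (two_ne_zero (α := ℂ)) h]

theorem slash_lower_sq (R : WeylCliffordRelations η g x d) (hη : η * ηinv = 1) :
    slash g (lower ηinv x) * slash g (lower ηinv x) = -lowering ηinv x := by
  have h := clifford_sum_anticommutator η 0 g (lower ηinv x) (lower ηinv x) R.clifford
    R.g_mul_lower R.g_mul_lower (by simp [R.lower_mul_lower])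
  have hs : ∑ i, ∑ j, (2 * η i j) • (lower ηinv x i * lower ηinv x j) =
      (2 : ℂ) • ∑ i, x i * lower ηinv x i := by
    rw [Finset.smul_sum]
    refine Finset.sum_congr rfl fun i _ => ?_
    rw [R.x_mul_lower, ← sum_smul_lower (x := x) hη i, Finset.mul_sum, Finset.smul_sum]
    exact Finset.sum_congr rfl fun j _ => by rw [mul_smul_comm, smul_smul]
  simp only [Pi.zero_apply, zero_smul, sub_zero, hs, ← two_smul ℂ] at h
  rw [slash, smul_mul_smul_comm, I_div_sqrt_two_mul_self, lowering,
    smul_right_injective A (two_ne_zero (α := ℂ)) h, neg_smul]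

theorem slash_anticommutator (R : WeylCliffordRelations η g x d) (hη : η * ηinv = 1)
    (hsym : ∀ i j, η i j = η j i) (hsym' : ∀ i j, ηinv i j = ηinv j i) :
    slash g (lower ηinv x) * slash g d + slash g d * slash g (lower ηinv x) = weight x d := by
  have h := clifford_sum_anticommutator η (fun i j => -ηinv i j) g (lower ηinv x) d
    R.clifford R.g_mul_lower R.g_d R.lower_d_commutator
  have hs : ∑ i, ∑ j, (2 * η i j) • (lower ηinv x i * d j) = (2 : ℂ) • ∑ i, x i * d i := by
    rw [Finset.sum_comm, Finset.smul_sum]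
    refine Finset.sum_congr rfl fun i _ => ?_
    rw [← sum_smul_lower (x := x) hη i, Finset.sum_mul, Finset.smul_sum]
    exact Finset.sum_congr rfl fun j _ => by rw [hsym, smul_mul_assoc, smul_smul]
  simp only [neg_smul, sub_neg_eq_add, Finset.sum_add_distrib, hs,
    sum_inverse_smul_clifford η ηinv g R.clifford hsym' hη] at h
  rw [slash, slash, smul_mul_smul_comm, smul_mul_smul_comm, I_div_sqrt_two_mul_self, ← smul_add,
    h, R.weight_eq]
  module

end WeylCliffordRelations

end SuperOscillator

theorem inverse_symmetric_of_symmetric {ι : Type*} [Fintype ι] [DecidableEq ι]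
    {η ηinv : Matrix ι ι ℂ} (hsym : ∀ i j, η i j = η j i) (hη : η * ηinv = 1) (i j : ι) :
    ηinv i j = ηinv j i := by
  have hT : η.IsSymm := Matrix.IsSymm.ext fun i j => hsym j i
  rw [← Matrix.inv_eq_right_inv hη]
  exact hT.inv.apply j i

/-- Two odd elements `X`, `Y` whose anticommutator `H` satisfies `[H, X] = X` and `[H, Y] = -Y`
span, together with their squares, a quotient of `osp(1|2)`, which is all of it when `H ≠ 0`. -/
theorem osp_relations_of_odd_generators {A : Type*} [Ring A] [Algebra ℂ A] {H E F X Y : A}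
    (hXX : X * X = E) (hYY : Y * Y = -F) (hYX : Y * X + X * Y = H)
    (hHX : H * X - X * H = X) (hHY : H * Y - Y * H = -Y) (hH0 : H ≠ 0) :
    (H * E - E * H = (2 : ℂ) • E) ∧ (H * F - F * H = (-2 : ℂ) • F) ∧
    (H * X - X * H = X) ∧ (H * Y - Y * H = -Y) ∧
    (X * X + X * X = (2 : ℂ) • E) ∧ (Y * Y + Y * Y = (-2 : ℂ) • F) ∧ (Y * X + X * Y = H) ∧
    (E * F - F * E = H) ∧ (Y * E - E * Y = X) ∧ (X * F - F * X = Y) ∧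
    (Y * F - F * Y = 0) ∧ (X * E - E * X = 0) ∧ LinearIndependent ℂ ![H, E, F, X, Y] := by
  obtain rfl : F = -(Y * Y) := by rw [hYY, neg_neg]
  subst hXX
  have hHE : H * (X * X) - X * X * H = (2 : ℂ) • (X * X) := by
    calc _ = (H * X - X * H) * X + X * (H * X - X * H) := by noncomm_ring
      _ = _ := by rw [hHX, two_smul]
  have hHF : H * -(Y * Y) - -(Y * Y) * H = (-2 : ℂ) • -(Y * Y) := by
    calc _ = -((H * Y - Y * H) * Y + Y * (H * Y - Y * H)) := by noncomm_ring
      _ = _ := by rw [hHY, neg_smul, two_smul]; noncomm_ring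
  have hXF : X * -(Y * Y) - -(Y * Y) * X = Y := by
    calc _ = -((Y * X + X * Y) * Y - Y * (Y * X + X * Y)) := by noncomm_ring
      _ = _ := by rw [hYX, hHY, neg_neg]
  have hYE : Y * (X * X) - X * X * Y = X := by
    calc _ = (Y * X + X * Y) * X - X * (Y * X + X * Y) := by noncomm_ring
      _ = _ := by rw [hYX, hHX]
  have hEF : X * X * -(Y * Y) - -(Y * Y) * (X * X) = H := by
    calc _ = (X * -(Y * Y) - -(Y * Y) * X) * X + X * (X * -(Y * Y) - -(Y * Y) * X) := by
          noncomm_ring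
      _ = _ := by rw [hXF, hYX]
  refine ⟨hHE, hHF, hHX, hHY, (two_smul ℂ _).symm,
    by rw [neg_smul, smul_neg, neg_neg, two_smul], hYX, hEF, hYE, hXF, by noncomm_ring,
    by noncomm_ring, ?_⟩
  have hX0 : X ≠ 0 := by rintro rfl; simp at hYX; exact hH0 hYX.symm
  have hY0 : Y ≠ 0 := by rintro rfl; simp at hYX; exact hH0 hYX.symm
  have hE0 : X * X ≠ 0 := by intro h; rw [h] at hEF; simp at hEF; exact hH0 hEF.symm
  have hF0 : -(Y * Y) ≠ 0 := by intro h; rw [h] at hEF; simp at hEF; exact hH0 hEF.symm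
  refine Module.End.eigenvectors_linearIndependent'
    (LinearMap.mulLeft ℂ H - LinearMap.mulRight ℂ H) ![(0 : ℂ), 2, -2, 1, -1] ?_ _ ?_
  · intro i j
    fin_cases i <;> fin_cases j <;> norm_num [Fin.ext_iff]
  · intro i
    rw [Module.End.hasEigenvector_iff, Module.End.mem_eigenspace_iff]
    fin_cases i
    · exact ⟨by simp, hH0⟩
    · exact ⟨hHE, hE0⟩
    · exact ⟨hHF, hF0⟩
    · exact ⟨by simpa using hHX, hX0⟩
    · exact ⟨by simpa using hHY, hY0⟩

section Operators

open scoped TensorProduct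
open SuperOscillator

variable {n : ℕ} (η : Matrix (Fin n) (Fin n) ℂ)

theorem gammaElem_anticommutator (hsym : ∀ i j, η i j = η j i) (i j : Fin n) :
    gammaElem η i * gammaElem η j + gammaElem η j * gammaElem η i =
      algebraMap ℂ _ (2 * η i j) := by
  have h : QuadraticMap.polar (LinearMap.BilinMap.toQuadraticMap (Matrix.toLinearMap₂' ℂ η))
      (Pi.single i (1 : ℂ)) (Pi.single j (1 : ℂ)) = 2 * η i j := by
    simp [LinearMap.BilinMap.polar_toQuadraticMap, Matrix.toLinearMap₂'_apply, Pi.single_apply,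
      hsym j i, two_mul]
  rw [gammaElem, gammaElem, CliffordAlgebra.ι_mul_ι_add_swap]
  exact congrArg _ h

theorem gop_anticommutator (hsym : ∀ i j, η i j = η j i) (i j : Fin n) :
    gop η i * gop η j + gop η j * gop η i = (2 * η i j) • (1 : Module.End ℂ (WCModule n η)) := by
  refine TensorProduct.ext' fun c p => ?_
  simp only [gop, LinearMap.add_apply, Module.End.mul_apply, LinearMap.rTensor_tmul,
    LinearMap.mulLeft_apply, ← TensorProduct.add_tmul, ← mul_assoc, ← add_mul,
    gammaElem_anticommutator η hsym]
  simp [Algebra.smul_def, TensorProduct.smul_tmul', mul_assoc]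

theorem gop_mul_xop (i j : Fin n) : gop η i * xop η j = xop η j * gop η i :=
  TensorProduct.ext' fun c p => by simp [gop, xop]

theorem gop_mul_dop (i j : Fin n) : gop η i * dop η j = dop η j * gop η i :=
  TensorProduct.ext' fun c p => by simp [gop, dop]

theorem xop_mul_xop (i j : Fin n) : xop η i * xop η j = xop η j * xop η i :=
  TensorProduct.ext' fun c p => by simp [xop, mul_left_comm]

theorem dop_mul_dop (i j : Fin n) : dop η i * dop η j = dop η j * dop η i := by
  have h : ⁅MvPolynomial.pderiv (R := ℂ) i, MvPolynomial.pderiv (R := ℂ) j⁆ = 0 := by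
    refine MvPolynomial.derivation_ext fun k => ?_
    simp [Derivation.commutator_apply, MvPolynomial.pderiv_X, Pi.single_apply, apply_ite]
  refine TensorProduct.ext' fun c p => ?_
  have h' := DFunLike.congr_fun h p
  simp only [Derivation.commutator_apply, Derivation.zero_apply, sub_eq_zero] at h'
  simp [dop, h']

theorem dop_mul_xop (i j : Fin n) :
    dop η i * xop η j = xop η j * dop η i + if i = j then 1 else 0 := by
  refine TensorProduct.ext' fun c p => ?_
  simp only [dop, xop, LinearMap.add_apply, Module.End.mul_apply, LinearMap.lTensor_tmul,
    LinearMap.mulLeft_apply]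
  by_cases h : i = j
  · subst h; simp [TensorProduct.tmul_add]
  · simp [h, MvPolynomial.pderiv_X_of_ne (Ne.symm h)]

theorem weylCliffordRelations (hsym : ∀ i j, η i j = η j i) :
    WeylCliffordRelations η (gop η) (xop η) (dop η) where
  clifford := gop_anticommutator η hsym
  g_x := gop_mul_xop η
  g_d := gop_mul_dop η
  x_x := xop_mul_xop η
  d_d := dop_mul_dop η
  d_x := dop_mul_xop η

theorem Hop_ne_zero (hn : 0 < n) : Hop η ≠ 0 := by
  intro h
  have h1 : Hop η (1 ⊗ₜ[ℂ] 1) = 0 := by rw [h]; rfl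
  have hd (i : Fin n) : dop η i (1 ⊗ₜ[ℂ] 1) = 0 := by simp [dop]
  have hx (i : Fin n) : dop η i (xop η i (1 ⊗ₜ[ℂ] 1)) = 1 ⊗ₜ[ℂ] 1 := by simp [dop, xop]
  simp only [Hop, LinearMap.smul_apply, LinearMap.sum_apply, LinearMap.add_apply,
    Module.End.mul_apply, hd, hx, map_zero, add_zero, Finset.sum_const, Finset.card_univ,
    Fintype.card_fin, ← Nat.cast_smul_eq_nsmul ℂ, smul_smul, smul_eq_zero] at h1
  rcases h1 with h1 | h1
  · simp [hn.ne'] at h1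
  · exact one_ne_zero (α := WCModule n η) h1

end Operators

/-- there is an injective homomorphism of Lie superalgebras
`ψ : osp(1|2) → W(2n|n)` determined by
`ψ(x) = (i/√2)γ^i∂_i`, `ψ(y) = (i/√2)γ^i x_i`, `ψ(h) = -(1/2)(∂_i x^i + x^i∂_i)`,
`ψ(e) = -(1/2)∂^i∂_i`, `ψ(f) = (1/2)x^i x_i`, where `W(2n|n)` carries the supercommutator
Lie superalgebra structure.  Concretely (realizing `W(2n|n)` faithfully on Clifford-valued
polynomials): the five images `H, E, F, X, Y` satisfy all the defining supercommutator
relations of `osp(1|2)` (commutators for even–even and even–odd pairs, anticommutators for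
odd–odd pairs), and are `ℂ`-linearly independent — i.e. the induced linear map `ψ` is an
injective morphism of Lie superalgebras. -/
theorem osp_embedding {n : ℕ} (hn : 0 < n)
    (η ηinv : Matrix (Fin n) (Fin n) ℂ)
    (hsym : ∀ i j, η i j = η j i)
    (hη : η * ηinv = 1) (hη' : ηinv * η = 1) :
    -- [h,e] = 2e, [h,f] = -2f, [h,x] = x, [h,y] = -y
    (Hop η * Eop η - Eop η * Hop η = (2:ℂ) • Eop η) ∧
    (Hop η * Fop η ηinv - Fop η ηinv * Hop η = (-2:ℂ) • Fop η ηinv) ∧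
    (Hop η * Xop η - Xop η * Hop η = Xop η) ∧
    (Hop η * Yop η ηinv - Yop η ηinv * Hop η = -(Yop η ηinv)) ∧
    -- [x,x] = 2e, [y,y] = -2f, [y,x] = h (anticommutators)
    (Xop η * Xop η + Xop η * Xop η = (2:ℂ) • Eop η) ∧
    (Yop η ηinv * Yop η ηinv + Yop η ηinv * Yop η ηinv = (-2:ℂ) • Fop η ηinv) ∧
    (Yop η ηinv * Xop η + Xop η * Yop η ηinv = Hop η) ∧
    -- [e,f] = h, [y,e] = x, [x,f] = y, [y,f] = 0, [x,e] = 0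
    (Eop η * Fop η ηinv - Fop η ηinv * Eop η = Hop η) ∧
    (Yop η ηinv * Eop η - Eop η * Yop η ηinv = Xop η) ∧
    (Xop η * Fop η ηinv - Fop η ηinv * Xop η = Yop η ηinv) ∧
    (Yop η ηinv * Fop η ηinv - Fop η ηinv * Yop η ηinv = 0) ∧
    (Xop η * Eop η - Eop η * Xop η = 0) ∧
    -- injectivity: the images of the basis h, e, f, x, y are linearly independent
    LinearIndependent ℂ
      ![Hop η, Eop η, Fop η ηinv, Xop η, Yop η ηinv] := by
  have R := weylCliffordRelations η hsym
  exact osp_relations_of_odd_generators R.slash_d_sq (R.slash_lower_sq hη)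
    (R.slash_anticommutator hη hsym (inverse_symmetric_of_symmetric hsym hη))
    R.weight_commutator_slash_d R.weight_commutator_slash_lower (Hop_ne_zero η hn)
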